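/- For every vertex v ∈ V and every index 0 ≤ i ≤ k−1, the pivot p_i(v) belongs to the bunch B(v). -/

import Mathlib

/-- For every vertex `v ∈ V` and every index `0 ≤ i ≤ k−1`,
the pivot `p_i(v)` belongs to the bunch `B(v)`. -/
theorem pivot_mem_bunch
    {V : Type*} [MetricSpace V] [Fintype V]
    (k : ℕ) (hk : 2 ≤ k)
    -- the nested sets `V = A_0 ⊇ A_1 ⊇ ⋯ ⊇ A_{k-1}`, `A_k = ∅`
    (A : ℕ → Set V)
    (hA0 : A 0 = Set.univ)
    (hAanti : ∀ i < k, A (i + 1) ⊆ A i)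
    (hAne : (A (k - 1)).Nonempty)
    (hAk : A k = ∅)
    -- the pivots `p_i(v)`
    (p : V → ℕ → V)
    (hpmem : ∀ v : V, ∀ i ≤ k - 1, p v i ∈ A i)
    (hpmin : ∀ v : V, ∀ i ≤ k - 1, ∀ w ∈ A i, dist v (p v i) ≤ dist v w)
    (hptie : ∀ v : V, ∀ i : ℕ, i + 1 ≤ k - 1 →
      dist v (p v i) = dist v (p v (i + 1)) → p v i = p v (i + 1))
    -- the bunch `B(v) = ⋃_{i ≤ k-1} B_i(v)` (dist to the empty set is ∞)
    (B : V → Set V)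
    (hB : ∀ v u : V, u ∈ B v ↔
      ∃ i ≤ k - 1, u ∈ A i ∧ ∀ w ∈ A (i + 1), dist v u < dist v w)
    (v : V) (i : ℕ) (hi : i ≤ k - 1) :
    p v i ∈ B v := by
  induction hi using Nat.decreasingInduction with
  | self =>
    refine (hB _ _).2 ⟨k - 1, le_rfl, hpmem v _ le_rfl, ?_⟩
    intro w hw
    have h : k - 1 + 1 = k := by omega
    rw [h, hAk] at hw
    exact hw.elim
  | of_succ i hi ih =>
    have h1 : i + 1 ≤ k - 1 := hi
    have h0 : i ≤ k - 1 := by omega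
    by_cases h : dist v (p v i) = dist v (p v (i + 1))
    · rw [hptie v i h1 h]
      exact ih
    · refine (hB _ _).2 ⟨i, h0, hpmem v i h0, ?_⟩
      intro w hw
      have hle := hpmin v i h0 _ (hAanti i (by omega) (hpmem v (i + 1) h1))
      exact lt_of_lt_of_le (lt_of_le_of_ne hle h) (hpmin v (i + 1) h1 w hw)
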